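/- Let R be a 𝒰_𝒳-hereditary ring. Then the class of 𝒰_𝒳-projective modules is closed under pure submodules: if A is a pure submodule of a 𝒰_𝒳-projective module H, then A is 𝒰_𝒳-projective. -/

import Mathlib

open CategoryTheory Limits Opposite

/-- `Ext^n_R(X, M) = 0`, phrased via the `Ext` bifunctor on `ModuleCat R`. -/
def extZero (R : Type) [Ring R] (n : ℕ) (X M : ModuleCat R) : Prop :=
  IsZero (((Ext ℤ (ModuleCat R) n).obj (op X)).obj M)

/-- `M` is `𝒳`-injective if `Ext¹(X, M) = 0` for every `X ∈ 𝒳`. -/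
def IsXInjective (R : Type) [Ring R] (𝒳 : ModuleCat R → Prop) (M : ModuleCat R) : Prop :=
  ∀ X, 𝒳 X → extZero R 1 X M

/-- `M` is `𝒰_𝒳`-projective if `Ext¹(M, U) = 0` for every `𝒳`-injective module `U`. -/
def IsUXProjective (R : Type) [Ring R] (𝒳 : ModuleCat R → Prop) (M : ModuleCat R) : Prop :=
  ∀ U : ModuleCat R, IsXInjective R 𝒳 U → extZero R 1 M U

/-- `Ext¹(M, U)` vanishes iff cocycles on a projective resolution of `M` are coboundaries. -/
lemma extZero_one_iff_resolution {R : Type} [Ring R] {M : ModuleCat R} (P : ProjectiveResolution M)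
    (U : ModuleCat R) :
    extZero R 1 M U ↔ ∀ f : P.complex.X 1 ⟶ U, P.complex.d 2 1 ≫ f = 0 →
      ∃ g : P.complex.X 0 ⟶ U, P.complex.d 1 0 ≫ g = f := by
  rw [extZero, (P.isoExt 1 U).isZero_iff, ← HomologicalComplex.exactAt_iff_isZero_homology,
    HomologicalComplex.exactAt_iff' _ 0 1 2 (by simp) (by simp), ShortComplex.moduleCat_exact_iff]
  rfl

/-- A linear map vanishing on the kernel of a surjection factors through that surjection. -/
lemma exists_comp_eq_of_ker_le {R A B U : Type*} [Ring R] [AddCommGroup A] [Module R A]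
    [AddCommGroup B] [Module R B] [AddCommGroup U] [Module R U] (p : A →ₗ[R] B)
    (hp : Function.Surjective p) (h : A →ₗ[R] U) (hle : ∀ a, p a = 0 → h a = 0) :
    ∃ g : B →ₗ[R] U, ∀ a, g (p a) = h a := by
  refine ⟨(LinearMap.ker p).liftQ h hle ∘ₗ (p.quotKerEquivOfSurjective hp).symm.toLinearMap,
    fun a => ?_⟩
  have : (p.quotKerEquivOfSurjective hp).symm (p a) = (LinearMap.ker p).mkQ a := by
    rw [LinearEquiv.symm_apply_eq]; rfl
  rw [LinearMap.comp_apply, LinearEquiv.coe_coe, this, Submodule.mkQ_apply]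
  exact Submodule.liftQ_apply _ _ _

/-- Linear maps to `U` extend along the kernel inclusion of every surjection onto `M`. -/
def ExtendsFromKernels (R : Type) [Ring R] (M U : Type) [AddCommGroup M] [Module R M]
    [AddCommGroup U] [Module R U] : Prop :=
  ∀ (E : Type) [AddCommGroup E] [Module R E] (q : E →ₗ[R] M), Function.Surjective q →
    ∀ f : LinearMap.ker q →ₗ[R] U, ∃ g : E →ₗ[R] U, ∀ x : LinearMap.ker q, g x = f x

/-- `Ext¹(M, U)` vanishes iff maps to `U` extend from the kernel of any surjection onto `M`. -/
lemma extZero_one_iff_extendsFromKernels {R : Type} [Ring R] (M U : ModuleCat R) :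
    extZero R 1 M U ↔ ExtendsFromKernels R M U := by
  obtain ⟨P⟩ : Nonempty (ProjectiveResolution M) := HasProjectiveResolution.out
  let π : P.complex.X 0 ⟶ M := P.π.f 0
  have hπ : Function.Surjective π := (ModuleCat.epi_iff_surjective (P.π.f 0)).1 inferInstance
  have hdπ : P.complex.d 1 0 ≫ π = 0 := P.complex_d_comp_π_f_zero
  have hexact : ∀ x, π x = 0 → ∃ y, P.complex.d 1 0 y = x :=
    (ShortComplex.moduleCat_exact_iff _).1 (P.exact₀)
  have hexact' : ∀ x, P.complex.d 1 0 x = 0 → ∃ y, P.complex.d 2 1 y = x :=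
    (ShortComplex.moduleCat_exact_iff _).1 (P.exact_succ 0)
  have hd : ∀ y, π (P.complex.d 1 0 y) = 0 := fun y =>
    LinearMap.congr_fun (congrArg ModuleCat.Hom.hom hdπ) y
  rw [extZero_one_iff_resolution P]
  constructor
  · intro h E _ _ q hq f
    have : Module.Projective R (P.complex.X 0) :=
      (IsProjective.iff_projective (P.complex.X 0)).2 (P.projective 0)
    obtain ⟨φ, hφ⟩ := Module.projective_lifting_property q π.hom hq
    have hφ' : ∀ x, q (φ x) = π x := LinearMap.congr_fun hφ
    let c : P.complex.X 1 →ₗ[R] LinearMap.ker q :=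
      (φ ∘ₗ (P.complex.d 1 0).hom).codRestrict _ fun y => by
        simpa [hφ'] using hd y
    obtain ⟨g, hg⟩ := h (ModuleCat.ofHom (f ∘ₗ c)) (by
      ext y
      have : c (P.complex.d 2 1 y) = 0 := by
        ext
        have := LinearMap.congr_fun (congrArg ModuleCat.Hom.hom (P.complex.d_comp_d 2 1 0)) y
        exact (congrArg φ this).trans (map_zero φ)
      simp [this])
    have hg' : ∀ y, g (P.complex.d 1 0 y) = f (c y) :=
      LinearMap.congr_fun (congrArg ModuleCat.Hom.hom hg)
    obtain ⟨k, hk⟩ := exists_comp_eq_of_ker_le (φ.coprod (LinearMap.ker q).subtype)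
      (fun e => by
        obtain ⟨x, hx⟩ := hπ (q e)
        exact ⟨(x, ⟨e - φ x, by simp [hφ', hx]⟩), by simp⟩)
      (g.hom.coprod f) (by
        rintro ⟨x, k⟩ hxk
        simp only [LinearMap.coprod_apply, Submodule.subtype_apply] at hxk ⊢
        obtain ⟨y, rfl⟩ := hexact x (by
          have := congrArg q hxk
          rwa [map_add, hφ', LinearMap.mem_ker.1 k.2, add_zero, map_zero] at this)
        have : c y + k = 0 := Subtype.ext hxk
        rw [hg', ← map_add, this, map_zero])
    exact ⟨k, fun x => by simpa using hk (0, x)⟩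
  · intro h f hf
    have hf' : ∀ y, f (P.complex.d 2 1 y) = 0 := fun y =>
      LinearMap.congr_fun (congrArg ModuleCat.Hom.hom hf) y
    let c : P.complex.X 1 →ₗ[R] LinearMap.ker π.hom :=
      (P.complex.d 1 0).hom.codRestrict _ hd
    obtain ⟨k, hk⟩ := exists_comp_eq_of_ker_le c
      (fun x => (hexact x x.2).imp fun y hy => Subtype.ext hy) f.hom (fun y hy => by
        obtain ⟨z, rfl⟩ := hexact' y (congrArg Subtype.val hy)
        exact hf' z)
    obtain ⟨g, hg⟩ := h _ π.hom hπ k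
    refine ⟨ModuleCat.ofHom g, ?_⟩
    ext y
    exact (hg (c y)).trans (hk y)

/-- The extension property passes to a quotient `A` of `B` if maps to `U` extend from the kernel
of `B → A`. -/
lemma ExtendsFromKernels.of_surjective {R : Type} [Ring R] {A B U : Type} [AddCommGroup A]
    [Module R A] [AddCommGroup B] [Module R B] [AddCommGroup U] [Module R U]
    (hB : ExtendsFromKernels R B U) (ρ : B →ₗ[R] A) (hρ : Function.Surjective ρ)
    (hker : ∀ f : LinearMap.ker ρ →ₗ[R] U, ∃ k : B →ₗ[R] U, ∀ x : LinearMap.ker ρ, k x = f x) :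
    ExtendsFromKernels R A U := by
  intro E _ _ q hq f
  let Q : Submodule R (E × B) := LinearMap.ker (q.coprod (-ρ))
  have hQ : ∀ z : Q, q z.1.1 = ρ z.1.2 := fun z => by
    have := LinearMap.mem_ker.1 z.2
    rwa [LinearMap.coprod_apply, LinearMap.neg_apply, ← sub_eq_add_neg, sub_eq_zero] at this
  let fstQ : Q →ₗ[R] E := LinearMap.fst R E B ∘ₗ Q.subtype
  let sndQ : Q →ₗ[R] B := LinearMap.snd R E B ∘ₗ Q.subtype
  have hfst : Function.Surjective fstQ := fun e => by
    obtain ⟨b, hb⟩ := hρ (q e)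
    exact ⟨⟨(e, b), by simp [Q, hb]⟩, rfl⟩
  have hsnd : Function.Surjective sndQ := fun b => by
    obtain ⟨e, he⟩ := hq (ρ b)
    exact ⟨⟨(e, b), by simp [Q, he]⟩, rfl⟩
  let κ : LinearMap.ker sndQ →ₗ[R] LinearMap.ker q :=
    (fstQ ∘ₗ (LinearMap.ker sndQ).subtype).codRestrict _ fun z =>
      (hQ z.1).trans ((congrArg ρ z.2).trans (map_zero ρ))
  obtain ⟨g, hg⟩ := hB Q sndQ hsnd (f ∘ₗ κ)
  let ι : LinearMap.ker ρ →ₗ[R] Q :=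
    (LinearMap.inr R E B ∘ₗ (LinearMap.ker ρ).subtype).codRestrict _ fun x => by simp [Q]
  obtain ⟨k, hk⟩ := hker (g ∘ₗ ι)
  obtain ⟨l, hl⟩ := exists_comp_eq_of_ker_le fstQ hfst (g - k ∘ₗ sndQ) (by
    intro z hz
    have hρz : ρ z.1.2 = 0 := (hQ z).symm.trans ((congrArg q hz).trans (map_zero q))
    have hιz : ι ⟨z.1.2, hρz⟩ = z := Subtype.ext (Prod.ext hz.symm rfl)
    have := hk ⟨z.1.2, hρz⟩
    rw [LinearMap.comp_apply, hιz] at this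
    exact sub_eq_zero.2 this.symm)
  refine ⟨l, fun x => ?_⟩
  let z : Q := ⟨(x, 0), by simp [Q]⟩
  have hgz : g z = f x := hg ⟨z, rfl⟩
  have hlz : l x = g z - k 0 := hl z
  rw [hlz, hgz, map_zero, sub_zero]

/-- The extension property passes to a submodule `A` of `H` if it holds for the preimage of `A`
under a surjection onto `H`. -/
lemma ExtendsFromKernels.submodule {R : Type} [Ring R] {F H U : Type} [AddCommGroup F] [Module R F]
    [AddCommGroup H] [Module R H] [AddCommGroup U] [Module R U] (hH : ExtendsFromKernels R H U)
    (A : Submodule R H) (π : F →ₗ[R] H) (hπ : Function.Surjective π)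
    (hB : ExtendsFromKernels R (A.comap π) U) : ExtendsFromKernels R A U := by
  let ρ : A.comap π →ₗ[R] A := π.restrict fun _ hx => hx
  refine hB.of_surjective ρ (fun a => ?_) fun f => ?_
  · obtain ⟨x, hx⟩ := hπ a
    exact ⟨⟨x, by simp [hx]⟩, Subtype.ext hx⟩
  · have hle : LinearMap.ker π ≤ A.comap π := fun x hx => by simp [LinearMap.mem_ker.1 hx]
    let ι : LinearMap.ker π →ₗ[R] LinearMap.ker ρ :=
      (Submodule.inclusion hle).codRestrict _ fun x => Subtype.ext x.2
    obtain ⟨k, hk⟩ := hH F π hπ (f ∘ₗ ι)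
    exact ⟨k ∘ₗ (A.comap π).subtype, fun x => hk ⟨x.1.1, congrArg Subtype.val x.2⟩⟩

/-- Over a `𝒰_𝒳`-hereditary ring (every submodule of a projective module is `𝒰_𝒳`-projective),
a pure submodule `A` of a `𝒰_𝒳`-projective module `H` is again `𝒰_𝒳`-projective.  Purity is
expressed by the (equivalent) lifting property of finitely presented modules along `H → H/A`. -/
theorem stmt8 (R : Type) [Ring R] (𝒳 : ModuleCat R → Prop)
    (hher : ∀ (P : Type) [AddCommGroup P] [Module R P], Module.Projective R P →
      ∀ N : Submodule R P, IsUXProjective R 𝒳 (ModuleCat.of R (↥N)))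
    (H : Type) [AddCommGroup H] [Module R H]
    (hH : IsUXProjective R 𝒳 (ModuleCat.of R H))
    (A : Submodule R H)
    (hpure : ∀ (F : Type) [AddCommGroup F] [Module R F], Module.FinitePresentation R F →
      ∀ g : F →ₗ[R] H ⧸ A, ∃ h : F →ₗ[R] H, A.mkQ.comp h = g) :
    IsUXProjective R 𝒳 (ModuleCat.of R (↥A)) := by
  intro U hU
  rw [extZero_one_iff_extendsFromKernels]
  exact ((extZero_one_iff_extendsFromKernels _ _).1 (hH U hU)).submodule A
    (Finsupp.linearCombination R id) (Finsupp.linearCombination_id_surjective R H)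
    ((extZero_one_iff_extendsFromKernels _ _).1 (hher (H →₀ R) inferInstance _ U hU))
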